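/- Fix real κ, v̄, σ, v₀, r with σ ≠ 0, t > 0, S₀ > 0, and u ∈ ℂ. For ρ ∈ ℝ define ξ(ρ) := κ − σρiu, d(ρ) := (ξ(ρ)² + σ²(u²+iu))^{1/2} (principal square root), A₁, A₂, A := A₁/A₂, X := (d+ξ)/2 + ((d−ξ)/2)e^{−dt}, D := Log d + (κ−d)t/2 − Log X, and φ(ρ) := exp( iu(log S₀ + rt) − tκv̄ρiu/σ − v₀·A + (2κv̄/σ²)·D ). Suppose at ρ₀: the radicand ξ(ρ₀)² + σ²(u²+iu) ∉ (−∞, 0], d(ρ₀) ∉ (−∞, 0], X(ρ₀) ∉ (−∞, 0], and A₂(ρ₀) ≠ 0. Then ρ ↦ φ(ρ) is differentiable at ρ₀ with derivative φ(ρ₀)·h₃, where h₃ := −v₀·Aρ' + (2κv̄/(σ²d))·( dρ' − (d/A₂)·A₂ρ' ) − tκv̄iu/σ, with dρ' := −ξσiu/d, A₁ρ' := −iu(u²+iu)tξσ cosh(dt/2)/(2d), A₂ρ' := −σiu(2+tξ)(ξ cosh(dt/2)+d sinh(dt/2))/(2d), and Aρ' := (1/A₂)A₁ρ' − (A/A₂)A₂ρ',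 all evaluated at ρ₀. -/

import Mathlib

noncomputable section

/-- Principal complex square root `z^{1/2} := exp((1/2)·Log z)`. -/
def csqrt (z : ℂ) : ℂ := Complex.exp ((1 / 2 : ℂ) * Complex.log z)

/-- `ξ(ρ) := κ − σρiu`. -/
def ξf (κ σ : ℝ) (u : ℂ) (ρ : ℝ) : ℂ := (κ : ℂ) - (σ : ℂ) * (ρ : ℂ) * Complex.I * u

/-- `d(ρ) := (ξ(ρ)² + σ²(u²+iu))^{1/2}` (principal square root). -/
def df (κ σ : ℝ) (u : ℂ) (ρ : ℝ) : ℂ :=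
  csqrt ((ξf κ σ u ρ) ^ 2 + (σ : ℂ) ^ 2 * (u ^ 2 + Complex.I * u))

/-- `A₁(ρ) := (u²+iu)·sinh(d(ρ)t/2)`. -/
def A₁f (κ σ t : ℝ) (u : ℂ) (ρ : ℝ) : ℂ :=
  (u ^ 2 + Complex.I * u) * Complex.sinh (df κ σ u ρ * (t : ℂ) / 2)

/-- `A₂(ρ) := d(ρ)·cosh(d(ρ)t/2) + ξ(ρ)·sinh(d(ρ)t/2)`. -/
def A₂f (κ σ t : ℝ) (u : ℂ) (ρ : ℝ) : ℂ :=
  df κ σ u ρ * Complex.cosh (df κ σ u ρ * (t : ℂ) / 2) +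
    ξf κ σ u ρ * Complex.sinh (df κ σ u ρ * (t : ℂ) / 2)

/-- `A(ρ) := A₁(ρ)/A₂(ρ)`. -/
def Af (κ σ t : ℝ) (u : ℂ) (ρ : ℝ) : ℂ := A₁f κ σ t u ρ / A₂f κ σ t u ρ

/-- `X(ρ) := (d+ξ)/2 + ((d−ξ)/2)·e^{−dt}`. -/
def Xf (κ σ t : ℝ) (u : ℂ) (ρ : ℝ) : ℂ :=
  (df κ σ u ρ + ξf κ σ u ρ) / 2 +
    (df κ σ u ρ - ξf κ σ u ρ) / 2 * Complex.exp (-(df κ σ u ρ * (t : ℂ)))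

/-- `D(ρ) := Log d + (κ−d)t/2 − Log X`. -/
def Df (κ σ t : ℝ) (u : ℂ) (ρ : ℝ) : ℂ :=
  Complex.log (df κ σ u ρ) + ((κ : ℂ) - df κ σ u ρ) * (t : ℂ) / 2 -
    Complex.log (Xf κ σ t u ρ)

/-- The Cui representation `φ(ρ)` of the Heston characteristic function as a function of `ρ`. -/
def φf (κ vb σ v₀ r t S₀ : ℝ) (u : ℂ) (ρ : ℝ) : ℂ :=
  Complex.exp (Complex.I * u * ((Real.log S₀ : ℂ) + (r : ℂ) * (t : ℂ))
    - (t : ℂ) * (κ : ℂ) * (vb : ℂ) * (ρ : ℂ) * Complex.I * u / (σ : ℂ)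
    - (v₀ : ℂ) * Af κ σ t u ρ + (2 * (κ : ℂ) * (vb : ℂ) / (σ : ℂ) ^ 2) * Df κ σ t u ρ)

theorem csqrt_mul_self {z : ℂ} (hz : z ≠ 0) : csqrt z * csqrt z = z := by
  rw [csqrt, ← Complex.exp_add, ← add_mul, add_halves, one_mul, Complex.exp_log hz]

theorem csqrt_ne_zero (z : ℂ) : csqrt z ≠ 0 := Complex.exp_ne_zero _

theorem hasDerivAt_csqrt {z : ℂ} (hz : z ∈ Complex.slitPlane) :
    HasDerivAt csqrt (1 / (2 * csqrt z)) z := by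
  have h := ((Complex.hasDerivAt_log hz).const_mul (1 / 2 : ℂ)).cexp
  refine h.congr_deriv ?_
  have hz0 := Complex.slitPlane_ne_zero hz
  have hsq := csqrt_mul_self hz0
  have hs := csqrt_ne_zero z
  change csqrt z * (1 / 2 * z⁻¹) = _
  field_simp
  linear_combination hsq

theorem hasDerivAt_ξf (κ σ : ℝ) (u : ℂ) (ρ : ℝ) :
    HasDerivAt (ξf κ σ u) (-((σ : ℂ) * Complex.I * u)) ρ := by
  have h := (((((hasDerivAt_id ρ).ofReal_comp).const_mul (σ : ℂ)).mul_const
    Complex.I).mul_const u).const_sub (κ : ℂ)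
  refine h.congr_deriv ?_
  simp

theorem hasDerivAt_df {κ σ : ℝ} {u : ℂ} {ρ : ℝ}
    (hw : (ξf κ σ u ρ) ^ 2 + (σ : ℂ) ^ 2 * (u ^ 2 + Complex.I * u) ∈ Complex.slitPlane) :
    HasDerivAt (df κ σ u) (-(ξf κ σ u ρ) * (σ : ℂ) * Complex.I * u / df κ σ u ρ) ρ := by
  have h := (hasDerivAt_csqrt hw).comp ρ
    (((hasDerivAt_ξf κ σ u ρ).pow 2).add_const ((σ : ℂ) ^ 2 * (u ^ 2 + Complex.I * u)))
  refine h.congr_deriv ?_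
  have hd : df κ σ u ρ ≠ 0 := csqrt_ne_zero _
  change 1 / (2 * df κ σ u ρ) * _ = _
  field_simp
  norm_num
  ring

/-- `A₂ = e^{dt/2}·X`. -/
theorem A₂f_eq_exp_mul_Xf (κ σ t : ℝ) (u : ℂ) (ρ : ℝ) :
    A₂f κ σ t u ρ = Complex.exp (df κ σ u ρ * (t : ℂ) / 2) * Xf κ σ t u ρ := by
  have h : Complex.exp (df κ σ u ρ * (t : ℂ) / 2) * Complex.exp (-(df κ σ u ρ * (t : ℂ))) =
      Complex.exp (-(df κ σ u ρ * (t : ℂ) / 2)) := by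
    rw [← Complex.exp_add]
    ring_nf
  rw [A₂f, Xf, Complex.cosh, Complex.sinh]
  linear_combination (-(df κ σ u ρ - ξf κ σ u ρ) / 2) * h

theorem hasDerivAt_A₁f {κ σ t : ℝ} {u : ℂ} {ρ : ℝ}
    (hw : (ξf κ σ u ρ) ^ 2 + (σ : ℂ) ^ 2 * (u ^ 2 + Complex.I * u) ∈ Complex.slitPlane) :
    HasDerivAt (A₁f κ σ t u) (-(Complex.I * u * (u ^ 2 + Complex.I * u) * (t : ℂ) *
      ξf κ σ u ρ * (σ : ℂ)) * Complex.cosh (df κ σ u ρ * (t : ℂ) / 2) /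
        (2 * df κ σ u ρ)) ρ := by
  have hd : df κ σ u ρ ≠ 0 := csqrt_ne_zero _
  have hs := (Complex.hasDerivAt_sinh _).comp ρ
    (((hasDerivAt_df hw).mul_const (t : ℂ)).div_const 2)
  refine (hs.const_mul (u ^ 2 + Complex.I * u)).congr_deriv ?_
  field_simp

theorem hasDerivAt_A₂f {κ σ t : ℝ} {u : ℂ} {ρ : ℝ}
    (hw : (ξf κ σ u ρ) ^ 2 + (σ : ℂ) ^ 2 * (u ^ 2 + Complex.I * u) ∈ Complex.slitPlane) :
    HasDerivAt (A₂f κ σ t u) (-((σ : ℂ) * Complex.I * u * (2 + (t : ℂ) * ξf κ σ u ρ)) *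
      (ξf κ σ u ρ * Complex.cosh (df κ σ u ρ * (t : ℂ) / 2) +
        df κ σ u ρ * Complex.sinh (df κ σ u ρ * (t : ℂ) / 2)) / (2 * df κ σ u ρ)) ρ := by
  have hd : df κ σ u ρ ≠ 0 := csqrt_ne_zero _
  have hd' := hasDerivAt_df hw
  have hdt := (hd'.mul_const (t : ℂ)).div_const 2
  refine ((hd'.mul ((Complex.hasDerivAt_cosh _).comp ρ hdt)).add
    ((hasDerivAt_ξf κ σ u ρ).mul ((Complex.hasDerivAt_sinh _).comp ρ hdt))).congr_deriv ?_
  simp only [Function.comp_apply]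
  field_simp
  ring

theorem hasDerivAt_Df {κ σ t : ℝ} {u : ℂ} {ρ : ℝ} {d' A₂' : ℂ}
    (hd : df κ σ u ρ ∈ Complex.slitPlane) (hX : Xf κ σ t u ρ ∈ Complex.slitPlane)
    (hd' : HasDerivAt (df κ σ u) d' ρ) (hA₂' : HasDerivAt (A₂f κ σ t u) A₂' ρ) :
    HasDerivAt (Df κ σ t u) (d' / df κ σ u ρ - A₂' / A₂f κ σ t u ρ) ρ := by
  have hX0 := Complex.slitPlane_ne_zero hX
  have hdt := (hd'.mul_const (t : ℂ)).div_const 2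
  have hX_eq : Xf κ σ t u =
      fun ρ => Complex.exp (-(df κ σ u ρ * (t : ℂ) / 2)) * A₂f κ σ t u ρ := by
    funext ρ
    rw [A₂f_eq_exp_mul_Xf, ← mul_assoc, ← Complex.exp_add, neg_add_cancel, Complex.exp_zero,
      one_mul]
  have hX' := hdt.neg.cexp.mul hA₂'
  have hX'' := hX'.congr_of_eventuallyEq (Filter.EventuallyEq.of_eq hX_eq)
  refine (((hd'.clog_real hd).add (((hd'.const_sub (κ : ℂ)).mul_const (t : ℂ)).div_const 2)).sub
    (hX''.clog_real hX)).congr_deriv ?_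
  have hA₂0 : A₂f κ σ t u ρ ≠ 0 := by
    rw [A₂f_eq_exp_mul_Xf]
    exact mul_ne_zero (Complex.exp_ne_zero _) hX0
  have hE := Complex.exp_ne_zero (-(df κ σ u ρ * (t : ℂ) / 2))
  have hd0 := Complex.slitPlane_ne_zero hd
  rw [congrFun hX_eq ρ]
  simp only [Pi.neg_apply]
  field_simp
  ring

/-- `∂φ/∂ρ = φ·h₃` with
`h₃ = −v₀·Aρ' + (2κv̄/(σ²d))·(dρ' − (d/A₂)·A₂ρ') − tκv̄iu/σ`. -/
theorem hasDerivAt_heston_charFn_rho (κ vb σ v₀ r t S₀ : ℝ) (hσ : σ ≠ 0) (ht : 0 < t)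
    (hS₀ : 0 < S₀) (u : ℂ) (ρ₀ : ℝ)
    (hw : (ξf κ σ u ρ₀) ^ 2 + (σ : ℂ) ^ 2 * (u ^ 2 + Complex.I * u) ∈ Complex.slitPlane)
    (hd : df κ σ u ρ₀ ∈ Complex.slitPlane)
    (hX : Xf κ σ t u ρ₀ ∈ Complex.slitPlane)
    (hA₂0 : A₂f κ σ t u ρ₀ ≠ 0)
    (dρ' A₁ρ' A₂ρ' Aρ' h₃ : ℂ)
    (hdρ' : dρ' = -(ξf κ σ u ρ₀) * (σ : ℂ) * Complex.I * u / df κ σ u ρ₀)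
    (hA₁ρ' : A₁ρ' = -(Complex.I * u * (u ^ 2 + Complex.I * u) * (t : ℂ) * ξf κ σ u ρ₀ *
      (σ : ℂ)) * Complex.cosh (df κ σ u ρ₀ * (t : ℂ) / 2) / (2 * df κ σ u ρ₀))
    (hA₂ρ' : A₂ρ' = -((σ : ℂ) * Complex.I * u * (2 + (t : ℂ) * ξf κ σ u ρ₀)) *
      (ξf κ σ u ρ₀ * Complex.cosh (df κ σ u ρ₀ * (t : ℂ) / 2) +
        df κ σ u ρ₀ * Complex.sinh (df κ σ u ρ₀ * (t : ℂ) / 2)) / (2 * df κ σ u ρ₀))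
    (hAρ' : Aρ' = (1 / A₂f κ σ t u ρ₀) * A₁ρ' - (Af κ σ t u ρ₀ / A₂f κ σ t u ρ₀) * A₂ρ')
    (hh₃ : h₃ = -(v₀ : ℂ) * Aρ' +
      (2 * (κ : ℂ) * (vb : ℂ) / ((σ : ℂ) ^ 2 * df κ σ u ρ₀)) *
        (dρ' - (df κ σ u ρ₀ / A₂f κ σ t u ρ₀) * A₂ρ') -
      (t : ℂ) * (κ : ℂ) * (vb : ℂ) * Complex.I * u / (σ : ℂ)) :
    HasDerivAt (φf κ vb σ v₀ r t S₀ u) (φf κ vb σ v₀ r t S₀ u ρ₀ * h₃) ρ₀ := by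
  have hd' := hasDerivAt_df hw
  have hA₁' := hasDerivAt_A₁f (t := t) hw
  have hA₂' := hasDerivAt_A₂f (t := t) hw
  rw [← hdρ'] at hd'
  rw [← hA₁ρ'] at hA₁'
  rw [← hA₂ρ'] at hA₂'
  have hd0 := Complex.slitPlane_ne_zero hd
  have hσ0 : (σ : ℂ) ≠ 0 := Complex.ofReal_ne_zero.mpr hσ
  have hA' : HasDerivAt (Af κ σ t u) Aρ' ρ₀ := by
    refine (hA₁'.div hA₂' hA₂0).congr_deriv ?_
    rw [hAρ', Af]
    field_simp
  have hlin := ((((((hasDerivAt_id ρ₀).ofReal_comp).const_mul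
    ((t : ℂ) * (κ : ℂ) * (vb : ℂ))).mul_const Complex.I).mul_const u).div_const (σ : ℂ))
  have h := (((hlin.const_sub (Complex.I * u * ((Real.log S₀ : ℂ) + (r : ℂ) * (t : ℂ)))).sub
    (hA'.const_mul (v₀ : ℂ))).add
    ((hasDerivAt_Df hd hX hd' hA₂').const_mul (2 * (κ : ℂ) * (vb : ℂ) / (σ : ℂ) ^ 2))).cexp
  refine h.congr_deriv ?_
  change φf κ vb σ v₀ r t S₀ u ρ₀ * _ = _
  rw [hh₃]
  congr 1
  push_cast
  field_simp
  ring
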